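/- The edge-inducibility constant λ_{5,4} equals 5/8. Moreover, the problem of maximising λ_{5,4} is perfectly stable with respect to the family of graphs that are vertex-disjoint unions of two (possibly empty) cliques. -/

import Mathlib

open Finset
open scoped Classical

/-- Number of edges of `G` inside the vertex subset `S`. -/
noncomputable def edgeCount {n : ℕ} (G : SimpleGraph (Fin n)) (S : Finset (Fin n)) : ℕ :=
  (Finset.univ.filter (fun p : Fin n × Fin n =>
    p.1 ∈ S ∧ p.2 ∈ S ∧ p.1 < p.2 ∧ G.Adj p.1 p.2)).card

/-- `Λ_{κ,ℓ}(G)`: number of `κ`-subsets of vertices inducing exactly `ℓ` edges. -/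
noncomputable def numKL (κ ℓ : ℕ) {n : ℕ} (G : SimpleGraph (Fin n)) : ℕ :=
  ((Finset.powersetCard κ Finset.univ).filter (fun S => edgeCount G S = ℓ)).card

/-- `λ_{κ,ℓ}(G) = Λ_{κ,ℓ}(G) / C(n,κ)`. -/
noncomputable def lamKL (κ ℓ : ℕ) {n : ℕ} (G : SimpleGraph (Fin n)) : ℝ :=
  (numKL κ ℓ G : ℝ) / (n.choose κ : ℝ)

/-- `λ_{κ,ℓ}(n)`: the maximum of `λ_{κ,ℓ}(G)` over all graphs on `n` vertices. -/
noncomputable def lamKLmax (κ ℓ n : ℕ) : ℝ :=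
  ⨆ G : SimpleGraph (Fin n), lamKL κ ℓ G

/-- Edit distance between two graphs on `Fin n`: the minimum over bijections of the number
of vertex pairs whose adjacency must be changed in `G` to obtain a graph isomorphic to `H`. -/
noncomputable def editDist {n : ℕ} (G H : SimpleGraph (Fin n)) : ℕ :=
  ⨅ σ : Equiv.Perm (Fin n),
    (Finset.univ.filter (fun p : Fin n × Fin n =>
      p.1 < p.2 ∧ ¬ (G.Adj p.1 p.2 ↔ H.Adj (σ p.1) (σ p.2)))).card

/-- Edit distance of `G` to the family of `n`-vertex graphs satisfying `P`. -/
noncomputable def distToFam {n : ℕ} (G : SimpleGraph (Fin n))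
    (P : SimpleGraph (Fin n) → Prop) : ℕ :=
  ⨅ H : {H : SimpleGraph (Fin n) // P H}, editDist G H.1

/-- A vertex-disjoint union of two (possibly empty) cliques. -/
def isTwoCliques {n : ℕ} (G : SimpleGraph (Fin n)) : Prop :=
  ∃ c : Fin n → Fin 2, ∀ u v, G.Adj u v ↔ (u ≠ v ∧ c u = c v)


/-! ### The flag-algebra certificate -/

/-- The first quadratic form (on rooted three-vertex graphs). -/
def tabA : List (List ℤ) :=
  [[23, -21, 19, -27, -17, -17], [-21, 37, -33, 22, 29, 29], [19, -33, 30, -20, -26, -27],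
   [-27, 22, -20, 34, 19, 18], [-17, 29, -26, 19, 24, 23], [-17, 29, -27, 18, 23, 25]]

/-- The second quadratic form (on one-vertex extensions of an edge plus an isolated vertex). -/
def tabB : List (List ℤ) :=
  [[109, 70, 70, -55, 55, -159, -159, -130], [70, 153, -59, -47, 47, 70, -286, -78],
   [70, -59, 153, -47, 47, -286, 70, -78], [-55, -47, -47, 196, -196, 144, 144, -18],
   [55, 47, 47, -196, 196, -144, -144, 18], [-159, 70, -286, 144, -144, 562, -42, 160],
   [-159, -286, 70, 144, -144, -42, 562, 160], [-130, -78, -78, -18, 18, 160, 160, 202]]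

def look (t : List (List ℤ)) (i j : ℕ) : ℤ := (t.getD i []).getD j 0

def sqA : List (ℕ × List ℤ) :=
  [(2728440, [23, -21, 19, -27, -17, -17]), (51480, [0, -61, 53, 53, -22, -45]),
   (2024, [0, 656, -583, 0, 585, 510]), (1219, [0, 67, 109, 0, 0, -285]),
   (50631165, [0, -1, 1, 0, 0, -1])]

def sqB : List (ℕ × List ℤ) :=
  [(13098396112900, [109, 70, 70, -55, 55, -159, -159, -130]),
   (58737202300, [0, 223, 223, -1273, 1273, -642, -642, 598]),
   (282639725, [0, 0, 0, 22652, -22652, 6723, 6723, -11658]),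
   (1288271, [0, 0, 0, 0, 0, 48925, 48925, 37994]),
   (5759984685736344, [0, 0, 0, 0, 0, 0, 0, 1]),
   (53876421747400, [0, 53, -53, 0, 0, 89, -89, 0]),
   (4417866583286800, [0, 0, 0, 0, 0, 1, -1, 0])]

def sqSum (s : List (ℕ × List ℤ)) (i j : ℕ) : ℤ :=
  (s.map (fun p => (p.1 : ℤ) * (p.2.getD i 0 * p.2.getD j 0))).sum

lemma tabA_eq : ∀ i < 6, ∀ j < 6, 62754120 * look tabA i j = sqSum sqA i j := by
  decide +kernel

lemma tabB_eq : ∀ i < 8, ∀ j < 8, 1427725176306100 * look tabB i j = sqSum sqB i j := by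
  decide +kernel

def flA (x y z : Bool) : ℕ := 2 * (x.toNat + y.toNat) + z.toNat
def flB (x y z : Bool) : ℕ := x.toNat + 2 * y.toNat + 4 * z.toNat

lemma flA_lt (x y z : Bool) : flA x y z < 6 := by cases x <;> cases y <;> cases z <;> decide
lemma flB_lt (x y z : Bool) : flB x y z < 8 := by cases x <;> cases y <;> cases z <;> decide

/-- A triple with an even number of edges (odd number of non-edges). -/
def badK (m : Fin 5 → Fin 5 → Bool) : ℤ := bif xor (m 0 1) (xor (m 0 2) (m 1 2)) then 0 else 1

def cnt (m : Fin 5 → Fin 5 → Bool) : ℕ :=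
  (m 0 1).toNat + (m 0 2).toNat + (m 0 3).toNat + (m 0 4).toNat + (m 1 2).toNat + (m 1 3).toNat
    + (m 1 4).toNat + (m 2 3).toNat + (m 2 4).toNat + (m 3 4).toNat

def phiK (m : Fin 5 → Fin 5 → Bool) : ℤ := bif cnt m == 4 then 1 else 0

def kerA (m : Fin 5 → Fin 5 → Bool) : ℤ :=
  look tabA (flA (m 0 1) (m 0 2) (m 1 2)) (flA (m 0 3) (m 0 4) (m 3 4))

def kerB (m : Fin 5 → Fin 5 → Bool) : ℤ :=
  bif m 0 1 && !(m 0 2) && !(m 1 2) then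
    look tabB (flB (m 0 3) (m 1 3) (m 2 3)) (flB (m 0 4) (m 1 4) (m 2 4)) else 0

def permsT : List (Fin 5 → Fin 5) :=
  [![0,1,2,3,4], ![0,1,3,2,4], ![0,1,4,2,3], ![0,2,3,1,4], ![0,2,4,1,3], ![0,3,4,1,2],
   ![1,2,3,0,4], ![1,2,4,0,3], ![1,3,4,0,2], ![2,3,4,0,1]]

def permsA : List (Fin 5 → Fin 5) :=
  [![0,1,2,3,4], ![0,1,3,2,4], ![0,1,4,2,3], ![1,0,2,3,4], ![1,0,3,2,4], ![1,0,4,2,3],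
   ![2,0,1,3,4], ![2,0,3,1,4], ![2,0,4,1,3], ![3,0,1,2,4], ![3,0,2,1,4], ![3,0,4,1,2],
   ![4,0,1,2,3], ![4,0,2,1,3], ![4,0,3,1,2]]

def permsB : List (Fin 5 → Fin 5) :=
  [![1,2,0,3,4], ![1,3,0,2,4], ![1,4,0,2,3], ![2,3,0,1,4], ![2,4,0,1,3], ![3,4,0,1,2],
   ![0,2,1,3,4], ![0,3,1,2,4], ![0,4,1,2,3], ![2,3,1,0,4], ![2,4,1,0,3], ![3,4,1,0,2],
   ![0,1,2,3,4], ![0,3,2,1,4], ![0,4,2,1,3], ![1,3,2,0,4], ![1,4,2,0,3], ![3,4,2,0,1],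
   ![0,1,3,2,4], ![0,2,3,1,4], ![0,4,3,1,2], ![1,2,3,0,4], ![1,4,3,0,2], ![2,4,3,0,1],
   ![0,1,4,2,3], ![0,2,4,1,3], ![0,3,4,1,2], ![1,2,4,0,3], ![1,3,4,0,2], ![2,3,4,0,1]]

def total (m : Fin 5 → Fin 5 → Bool) : ℤ :=
  750 - 3 * (permsT.map (fun p => badK (fun i j => m (p i) (p j)))).sum - 1200 * phiK m
    - 2 * (permsA.map (fun p => kerA (fun i j => m (p i) (p j)))).sum
    - (permsB.map (fun p => kerB (fun i j => m (p i) (p j)))).sum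

def gmk (b01 b02 b03 b04 b12 b13 b14 b23 b24 b34 : Bool) (i j : Fin 5) : Bool :=
  match i, j with
  | 0, 1 => b01 | 0, 2 => b02 | 0, 3 => b03 | 0, 4 => b04
  | 1, 0 => b01 | 2, 0 => b02 | 3, 0 => b03 | 4, 0 => b04
  | 1, 2 => b12 | 1, 3 => b13 | 1, 4 => b14
  | 2, 1 => b12 | 3, 1 => b13 | 4, 1 => b14
  | 2, 3 => b23 | 2, 4 => b24 | 3, 4 => b34
  | 3, 2 => b23 | 4, 2 => b24 | 4, 3 => b34
  | _, _ => true

/-- The same tables packed into one number each, for fast evaluation. -/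
def packA : ℕ :=
  136731041996414560674972586130751131108254675497119762806130124392629407635654879525754800772727821832847363128

def packB : ℕ :=
  2176230585965446452404616129302394393039056662829242225727184069856594124347374581943338973340278164487027408647000836888088791609095179234582430330366534745347618681652902159893184554660630923

def natT (x y z : Bool) : ℕ := bif xor x (xor y z) then 0 else 1

def natA (x y z x' y' z' : Bool) : ℕ :=
  Nat.shiftRight packA (8 * (8 * flA x y z + flA x' y' z')) % 256

def natB (x y z a b c a' b' c' : Bool) : ℕ :=
  bif x && !y && !z then
    Nat.shiftRight packB (10 * (8 * flB a b c + flB a' b' c')) % 1024 else 286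

def natP (b01 b02 b03 b04 b12 b13 b14 b23 b24 b34 : Bool) : ℕ :=
  bif b01.toNat + b02.toNat + b03.toNat + b04.toNat + b12.toNat + b13.toNat
    + b14.toNat + b23.toNat + b24.toNat + b34.toNat == 4 then 1 else 0

lemma natA_eq : ∀ x y z x' y' z' : Bool,
    look tabA (flA x y z) (flA x' y' z') = (natA x y z x' y' z' : ℤ) - 33 := by
  decide +kernel

lemma natB_eq : ∀ x y z a b c a' b' c' : Bool,
    (bif x && !y && !z then look tabB (flB a b c) (flB a' b' c') else 0) =
      (natB x y z a b c a' b' c' : ℤ) - 286 := by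
  decide +kernel

lemma natT_eq : ∀ x y z : Bool,
    (bif xor x (xor y z) then (0 : ℤ) else 1) = (natT x y z : ℤ) := by
  decide +kernel

def natSum (b01 b02 b03 b04 b12 b13 b14 b23 b24 b34 : Bool) : ℕ :=
  3 * (natT b01 b02 b12 + natT b01 b03 b13 + natT b01 b04 b14 + natT b02 b03 b23
    + natT b02 b04 b24 + natT b03 b04 b34 + natT b12 b13 b23 + natT b12 b14 b24
    + natT b13 b14 b34 + natT b23 b24 b34)
  + 1200 * natP b01 b02 b03 b04 b12 b13 b14 b23 b24 b34
  + 2 * (natA b01 b02 b12 b03 b04 b34 + natA b01 b03 b13 b02 b04 b24 + natA b01 b04 b14 b02 b03 b23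
    + natA b01 b12 b02 b13 b14 b34 + natA b01 b13 b03 b12 b14 b24 + natA b01 b14 b04 b12 b13 b23
    + natA b02 b12 b01 b23 b24 b34 + natA b02 b23 b03 b12 b24 b14 + natA b02 b24 b04 b12 b23 b13
    + natA b03 b13 b01 b23 b34 b24 + natA b03 b23 b02 b13 b34 b14 + natA b03 b34 b04 b13 b23 b12
    + natA b04 b14 b01 b24 b34 b23 + natA b04 b24 b02 b14 b34 b13 + natA b04 b34 b03 b14 b24 b12)
  + (natB b12 b01 b02 b13 b23 b03 b14 b24 b04 + natB b13 b01 b03 b12 b23 b02 b14 b34 b04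
    + natB b14 b01 b04 b12 b24 b02 b13 b34 b03 + natB b23 b02 b03 b12 b13 b01 b24 b34 b04
    + natB b24 b02 b04 b12 b14 b01 b23 b34 b03 + natB b34 b03 b04 b13 b14 b01 b23 b24 b02
    + natB b02 b01 b12 b03 b23 b13 b04 b24 b14 + natB b03 b01 b13 b02 b23 b12 b04 b34 b14
    + natB b04 b01 b14 b02 b24 b12 b03 b34 b13 + natB b23 b12 b13 b02 b03 b01 b24 b34 b14
    + natB b24 b12 b14 b02 b04 b01 b23 b34 b13 + natB b34 b13 b14 b03 b04 b01 b23 b24 b12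
    + natB b01 b02 b12 b03 b13 b23 b04 b14 b24 + natB b03 b02 b23 b01 b13 b12 b04 b34 b24
    + natB b04 b02 b24 b01 b14 b12 b03 b34 b23 + natB b13 b12 b23 b01 b03 b02 b14 b34 b24
    + natB b14 b12 b24 b01 b04 b02 b13 b34 b23 + natB b34 b23 b24 b03 b04 b02 b13 b14 b12
    + natB b01 b03 b13 b02 b12 b23 b04 b14 b34 + natB b02 b03 b23 b01 b12 b13 b04 b24 b34
    + natB b04 b03 b34 b01 b14 b13 b02 b24 b23 + natB b12 b13 b23 b01 b02 b03 b14 b24 b34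
    + natB b14 b13 b34 b01 b04 b03 b12 b24 b23 + natB b24 b23 b34 b02 b04 b03 b12 b14 b13
    + natB b01 b04 b14 b02 b12 b24 b03 b13 b34 + natB b02 b04 b24 b01 b12 b14 b03 b23 b34
    + natB b03 b04 b34 b01 b13 b14 b02 b23 b24 + natB b12 b14 b24 b01 b02 b04 b13 b23 b34
    + natB b13 b14 b34 b01 b03 b04 b12 b23 b24 + natB b23 b24 b34 b02 b03 b04 b12 b13 b14)

def allB (f : Bool → Bool) : Bool := f true && f false

lemma allB_spec {f : Bool → Bool} (h : allB f = true) (b : Bool) : f b = true := by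
  unfold allB at h
  cases b <;> simp_all

lemma natSum_check : (allB fun b01 => allB fun b02 => allB fun b03 => allB fun b04 =>
    allB fun b12 => allB fun b13 => allB fun b14 => allB fun b23 => allB fun b24 => allB fun b34 =>
    Nat.ble (natSum b01 b02 b03 b04 b12 b13 b14 b23 b24 b34) 10320) = true := by
  decide +kernel

lemma natSum_le (b01 b02 b03 b04 b12 b13 b14 b23 b24 b34 : Bool) :
    natSum b01 b02 b03 b04 b12 b13 b14 b23 b24 b34 ≤ 10320 := by
  have h := natSum_check
  exact Nat.le_of_ble_eq_true (allB_spec (allB_spec (allB_spec (allB_spec (allB_spec (allB_spec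
    (allB_spec (allB_spec (allB_spec (allB_spec h b01) b02) b03) b04) b12) b13) b14) b23) b24) b34)

lemma total_eq (b01 b02 b03 b04 b12 b13 b14 b23 b24 b34 : Bool) :
    total (gmk b01 b02 b03 b04 b12 b13 b14 b23 b24 b34) =
      10320 - (natSum b01 b02 b03 b04 b12 b13 b14 b23 b24 b34 : ℤ) := by
  have h1 : phiK (gmk b01 b02 b03 b04 b12 b13 b14 b23 b24 b34) =
      (natP b01 b02 b03 b04 b12 b13 b14 b23 b24 b34 : ℤ) := by
    unfold phiK natP
    rw [Bool.apply_cond (fun n : ℕ => (n : ℤ))]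
    rfl
  have hA : ∀ x y z x' y' z' : Bool, (natA x y z x' y' z' : ℤ) =
    look tabA (flA x y z) (flA x' y' z') + 33 := fun x y z x' y' z' => by rw [natA_eq]; ring
  have hB : ∀ x y z a b c a' b' c' : Bool, (natB x y z a b c a' b' c' : ℤ) =
    (bif x && !y && !z then look tabB (flB a b c) (flB a' b' c') else 0) + 286 :=
    fun x y z a b c a' b' c' => by rw [natB_eq]; ring
  unfold total natSum
  rw [h1]
  push_cast
  simp only [hA, hB, ← natT_eq]
  simp only [permsT, permsA, permsB, List.map_cons, List.map_nil, List.sum_cons, List.sum_nil,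
    badK, kerA, kerB]
  simp only [gmk, Matrix.cons_val]
  ring

lemma total_nonneg (b01 b02 b03 b04 b12 b13 b14 b23 b24 b34 : Bool) :
    0 ≤ total (gmk b01 b02 b03 b04 b12 b13 b14 b23 b24 b34) := by
  rw [total_eq]
  have := natSum_le b01 b02 b03 b04 b12 b13 b14 b23 b24 b34
  omega

/-! ### From the certificate to an inequality for sums over all five-tuples -/

lemma sqSum_nonneg {X : Type*} [Fintype X] (s : List (ℕ × List ℤ)) (φ : X → ℕ) :
    0 ≤ ∑ x, ∑ y, sqSum s (φ x) (φ y) := by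
  induction s with
  | nil => simp [sqSum]
  | cons p s ih =>
    have h : ∀ x y, sqSum (p :: s) (φ x) (φ y) =
        (p.1 : ℤ) * (p.2.getD (φ x) 0 * p.2.getD (φ y) 0) + sqSum s (φ x) (φ y) := by
      intro x y
      simp [sqSum]
    simp_rw [h, Finset.sum_add_distrib]
    have h2 : ∑ x, ∑ y, (p.1 : ℤ) * (p.2.getD (φ x) 0 * p.2.getD (φ y) 0) =
        (p.1 : ℤ) * (∑ x, p.2.getD (φ x) 0) ^ 2 := by
      simp_rw [← Finset.mul_sum]
      rw [sq, Finset.sum_mul]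
    rw [h2]
    positivity

lemma look_nonneg {X : Type*} [Fintype X] (s : List (ℕ × List ℤ)) (T : List (List ℤ)) (N : ℤ)
    (hN : 0 < N) (k : ℕ) (hT : ∀ i < k, ∀ j < k, N * look T i j = sqSum s i j)
    (φ : X → ℕ) (hφ : ∀ x, φ x < k) :
    0 ≤ ∑ x, ∑ y, look T (φ x) (φ y) := by
  have h := sqSum_nonneg s φ
  have h2 : ∑ x, ∑ y, sqSum s (φ x) (φ y) = N * ∑ x, ∑ y, look T (φ x) (φ y) := by
    simp_rw [Finset.mul_sum]
    exact Finset.sum_congr rfl fun x _ => Finset.sum_congr rfl fun y _ =>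
      (hT _ (hφ x) _ (hφ y)).symm
  rw [h2] at h
  exact nonneg_of_mul_nonneg_right h hN

/-- Five-tuples as functions versus iterated products. -/
def tupEquiv (V : Type*) : (Fin 5 → V) ≃ V × V × V × V × V where
  toFun v := (v 0, v 1, v 2, v 3, v 4)
  invFun p := ![p.1, p.2.1, p.2.2.1, p.2.2.2.1, p.2.2.2.2]
  left_inv v := by
    funext i
    fin_cases i <;> rfl
  right_inv p := rfl

lemma sum_tup {V M : Type*} [Fintype V] [AddCommMonoid M] (f : V → V → V → V → V → M) :
    ∑ v : Fin 5 → V, f (v 0) (v 1) (v 2) (v 3) (v 4) =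
      ∑ a, ∑ b, ∑ c, ∑ d, ∑ e, f a b c d e := by
  rw [← (tupEquiv V).symm.sum_comp]
  simp only [Fintype.sum_prod_type]
  rfl

lemma sum_perm {V M : Type*} [Fintype V] [AddCommMonoid M] (p : Fin 5 → Fin 5)
    (hp : Function.Bijective p) (g : (Fin 5 → V) → M) :
    ∑ v : Fin 5 → V, g (fun i => v (p i)) = ∑ v, g v := by
  exact ((Equiv.ofBijective p hp).symm.arrowCongr (Equiv.refl V)).sum_comp g

/-- The adjacency pattern of a tuple. -/
def tupM {V : Type*} (r : V → V → Bool) (v : Fin 5 → V) (i j : Fin 5) : Bool := r (v i) (v j)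

lemma sum_perms {V : Type*} [Fintype V] (r : V → V → Bool) (k : (Fin 5 → Fin 5 → Bool) → ℤ)
    (l : List (Fin 5 → Fin 5)) (hl : ∀ p ∈ l, Function.Bijective p) :
    ∑ v : Fin 5 → V, (l.map (fun p => k (fun i j => tupM r v (p i) (p j)))).sum =
      l.length * ∑ v : Fin 5 → V, k (tupM r v) := by
  induction l with
  | nil => simp
  | cons p l ih =>
    simp only [List.map_cons, List.sum_cons, Finset.sum_add_distrib, List.length_cons]
    rw [ih fun q hq => hl q (List.mem_cons_of_mem _ hq)]
    have := sum_perm p (hl p List.mem_cons_self) (fun v => k (tupM r v))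
    have h2 : ∑ v : Fin 5 → V, k (fun i j => tupM r v (p i) (p j)) =
      ∑ v : Fin 5 → V, k (tupM r v) := this
    rw [h2]
    push_cast
    ring

lemma perm_bij_of_inj {l : List (Fin 5 → Fin 5)} 
    (h : l.all (fun p => decide (List.ofFn p).Nodup) = true) :
    ∀ p ∈ l, Function.Bijective p := fun p hp =>
  (Finite.injective_iff_bijective).mp (List.nodup_ofFn.mp (of_decide_eq_true (List.all_eq_true.mp h p hp)))

lemma permsT_bij : ∀ p ∈ permsT, Function.Bijective p := perm_bij_of_inj (by decide +kernel)
lemma permsA_bij : ∀ p ∈ permsA, Function.Bijective p := perm_bij_of_inj (by decide +kernel)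
lemma permsB_bij : ∀ p ∈ permsB, Function.Bijective p := perm_bij_of_inj (by decide +kernel)

lemma tupM_eq {V : Type*} (r : V → V → Bool) (hr : ∀ x, r x x = true)
    (hs : ∀ x y, r x y = r y x) (v : Fin 5 → V) :
    tupM r v = gmk (r (v 0) (v 1)) (r (v 0) (v 2)) (r (v 0) (v 3)) (r (v 0) (v 4))
      (r (v 1) (v 2)) (r (v 1) (v 3)) (r (v 1) (v 4)) (r (v 2) (v 3)) (r (v 2) (v 4))
      (r (v 3) (v 4)) := by
  funext i j
  fin_cases i <;> fin_cases j <;> first | exact hr _ | rfl | exact hs _ _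

lemma kerA_sum {V : Type*} [Fintype V] (r : V → V → Bool) :
    0 ≤ ∑ v : Fin 5 → V, kerA (tupM r v) := by
  have h := sum_tup (fun a b c d e : V =>
    look tabA (flA (r a b) (r a c) (r b c)) (flA (r a d) (r a e) (r d e)))
  have h1 : ∑ v : Fin 5 → V, kerA (tupM r v) = _ := h
  rw [h1]
  refine Finset.sum_nonneg fun a _ => ?_
  have := look_nonneg (X := V × V) sqA tabA 62754120 (by norm_num) 6 tabA_eq
    (fun x => flA (r a x.1) (r a x.2) (r x.1 x.2)) (fun x => flA_lt _ _ _)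
  simpa only [Fintype.sum_prod_type] using this

lemma kerB_sum {V : Type*} [Fintype V] (r : V → V → Bool) :
    0 ≤ ∑ v : Fin 5 → V, kerB (tupM r v) := by
  have h := sum_tup (fun a b c d e : V =>
    bif r a b && !(r a c) && !(r b c) then
    look tabB (flB (r a d) (r b d) (r c d)) (flB (r a e) (r b e) (r c e)) else 0)
  have h1 : ∑ v : Fin 5 → V, kerB (tupM r v) = _ := h
  rw [h1]
  refine Finset.sum_nonneg fun a _ => Finset.sum_nonneg fun b _ => Finset.sum_nonneg fun c _ => ?_
  cases r a b && !(r a c) && !(r b c)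
  · simp
  · exact look_nonneg sqB tabB 1427725176306100 (by norm_num) 8 tabB_eq
      (fun x => flB (r a x) (r b x) (r c x)) (fun x => flB_lt _ _ _)

lemma flag_ineq {V : Type*} [Fintype V] (r : V → V → Bool) (hr : ∀ x, r x x = true)
    (hs : ∀ x y, r x y = r y x) :
    40 * ∑ v : Fin 5 → V, phiK (tupM r v) + ∑ v : Fin 5 → V, badK (tupM r v) ≤
      25 * (Fintype.card V : ℤ) ^ 5 := by
  have h0 : 0 ≤ ∑ v : Fin 5 → V, total (tupM r v) := by
    refine Finset.sum_nonneg fun v _ => ?_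
    rw [tupM_eq r hr hs]
    exact total_nonneg _ _ _ _ _ _ _ _ _ _
  unfold total at h0
  simp only [Finset.sum_sub_distrib, ← Finset.mul_sum] at h0
  rw [sum_perms r badK permsT permsT_bij, sum_perms r kerA permsA permsA_bij,
    sum_perms r kerB permsB permsB_bij] at h0
  have hA := kerA_sum r
  have hB := kerB_sum r
  simp only [Finset.sum_const, Finset.card_univ, Fintype.card_pi, Finset.prod_const,
    Fintype.card_fin, nsmul_eq_mul] at h0
  have l1 : permsT.length = 10 := rfl
  have l2 : permsA.length = 15 := rfl
  have l3 : permsB.length = 30 := rfl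
  rw [l1, l2, l3] at h0
  push_cast at h0
  linarith

/-! ### Comparing a graph with a union of two cliques -/

lemma exists_perm (k l : Fin 5) (h : k ≠ l) : ∃ p : Equiv.Perm (Fin 5), p 0 = k ∧ p 1 = l := by
  have h1 : Equiv.swap 0 k l ≠ 0 := by
    intro h2
    apply h
    have := congrArg (Equiv.swap 0 k) h2
    rw [Equiv.swap_apply_self, Equiv.swap_apply_left] at this
    exact this.symm
  refine ⟨Equiv.swap 0 k * Equiv.swap 1 (Equiv.swap 0 k l), ?_, ?_⟩
  · rw [Equiv.Perm.mul_apply, Equiv.swap_apply_of_ne_of_ne (by decide) h1.symm,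
      Equiv.swap_apply_left]
  · rw [Equiv.Perm.mul_apply, Equiv.swap_apply_left, Equiv.swap_apply_self]

section Compare

variable {V : Type*} [Fintype V]

/-- Indicator of a pair on which the two relations differ. -/
def dif (r s : V → V → Bool) (x y : V) : ℤ := bif r x y == s x y then 0 else 1

lemma dif_cases (r s : V → V → Bool) (x y : V) : dif r s x y = 0 ∨ dif r s x y = 1 := by
  unfold dif
  cases r x y == s x y <;> simp

lemma dif_nonneg (r s : V → V → Bool) (x y : V) : 0 ≤ dif r s x y := by
  rcases dif_cases r s x y with h | h <;> rw [h] <;> norm_num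

lemma dif_le_one (r s : V → V → Bool) (x y : V) : dif r s x y ≤ 1 := by
  rcases dif_cases r s x y with h | h <;> rw [h] <;> norm_num

lemma dif_key (r s : V → V → Bool) (x y : V) :
    ((r x y).toNat : ℤ) - (s x y).toNat ≤ dif r s x y ∧
    ((s x y).toNat : ℤ) - (r x y).toNat ≤ dif r s x y ∧
    ∃ t : ℤ, ((r x y).toNat : ℤ) + (s x y).toNat + dif r s x y = 2 * t := by
  unfold dif
  cases r x y <;> cases s x y <;> simp <;> first | exact ⟨0, by norm_num⟩ | exact ⟨1, by norm_num⟩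

/-- Number of differing pairs in a tuple. -/
def wsum (w : V → V → ℤ) (v : Fin 5 → V) : ℤ :=
  w (v 0) (v 1) + w (v 0) (v 2) + w (v 0) (v 3) + w (v 0) (v 4) + w (v 1) (v 2) + w (v 1) (v 3)
    + w (v 1) (v 4) + w (v 2) (v 3) + w (v 2) (v 4) + w (v 3) (v 4)

lemma wsum_two (w : V → V → ℤ) (hw : ∀ x y, w x y = w y x) (h0 : ∀ x, w x x = 0)
    (v : Fin 5 → V) : ∑ i, ∑ j, w (v i) (v j) = 2 * wsum w v := by
  simp only [Fin.sum_univ_five, h0, wsum]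
  rw [hw (v 1) (v 0), hw (v 2) (v 0), hw (v 3) (v 0), hw (v 4) (v 0), hw (v 2) (v 1),
    hw (v 3) (v 1), hw (v 4) (v 1), hw (v 3) (v 2), hw (v 4) (v 2), hw (v 4) (v 3)]
  ring

lemma wsum_perm (w : V → V → ℤ) (hw : ∀ x y, w x y = w y x) (h0 : ∀ x, w x x = 0)
    (v : Fin 5 → V) (p : Equiv.Perm (Fin 5)) : wsum w (fun i => v (p i)) = wsum w v := by
  have h1 := wsum_two w hw h0 (fun i => v (p i))
  have h2 := wsum_two w hw h0 v
  have h3 : ∑ i, ∑ j, w (v (p i)) (v (p j)) = ∑ i, ∑ j, w (v i) (v j) := by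
    rw [Equiv.sum_comp p (fun i => ∑ j, w (v i) (v (p j)))]
    exact Finset.sum_congr rfl fun i _ => Equiv.sum_comp p (fun j => w (v i) (v j))
  have h4 : ∑ i, ∑ j, w ((fun i => v (p i)) i) ((fun i => v (p i)) j) =
    ∑ i, ∑ j, w (v i) (v j) := h3
  omega

lemma phi_diff (r s : V → V → Bool) (v : Fin 5 → V) :
    phiK (tupM r v) - phiK (tupM s v) ≤ wsum (dif r s) v ∧
    phiK (tupM s v) - phiK (tupM r v) ≤ wsum (dif r s) v := by
  have h := fun i j => dif_key r s (v i) (v j)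
  have hn := fun i j => dif_nonneg r s (v i) (v j)
  have h01 := h 0 1; have h02 := h 0 2; have h03 := h 0 3; have h04 := h 0 4
  have h12 := h 1 2; have h13 := h 1 3; have h14 := h 1 4
  have h23 := h 2 3; have h24 := h 2 4; have h34 := h 3 4
  have n01 := hn 0 1; have n02 := hn 0 2; have n03 := hn 0 3; have n04 := hn 0 4
  have n12 := hn 1 2; have n13 := hn 1 3; have n14 := hn 1 4
  have n23 := hn 2 3; have n24 := hn 2 4; have n34 := hn 3 4
  have e1 : ((cnt (tupM r v) : ℕ) : ℤ) - cnt (tupM s v) ≤ wsum (dif r s) v := by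
    unfold cnt wsum tupM
    push_cast
    linarith [h01.1, h02.1, h03.1, h04.1, h12.1, h13.1, h14.1, h23.1, h24.1, h34.1]
  have e2 : ((cnt (tupM s v) : ℕ) : ℤ) - cnt (tupM r v) ≤ wsum (dif r s) v := by
    unfold cnt wsum tupM
    push_cast
    linarith [h01.2.1, h02.2.1, h03.2.1, h04.2.1, h12.2.1, h13.2.1, h14.2.1, h23.2.1, h24.2.1,
      h34.2.1]
  have e3 : 0 ≤ wsum (dif r s) v := by
    unfold wsum
    linarith
  unfold phiK
  rw [Bool.cond_eq_ite, Bool.cond_eq_ite]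
  simp only [beq_iff_eq]
  constructor <;> split_ifs <;> omega

lemma wsum_parity (r s : V → V → Bool) (v : Fin 5 → V) :
    ∃ t : ℤ, (cnt (tupM r v) : ℤ) + cnt (tupM s v) + wsum (dif r s) v = 2 * t := by
  have h := fun i j => (dif_key r s (v i) (v j)).2.2
  obtain ⟨t1, h1⟩ := h 0 1
  obtain ⟨t2, h2⟩ := h 0 2
  obtain ⟨t3, h3⟩ := h 0 3
  obtain ⟨t4, h4⟩ := h 0 4
  obtain ⟨t5, h5⟩ := h 1 2
  obtain ⟨t6, h6⟩ := h 1 3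
  obtain ⟨t7, h7⟩ := h 1 4
  obtain ⟨t8, h8⟩ := h 2 3
  obtain ⟨t9, h9⟩ := h 2 4
  obtain ⟨t10, h10⟩ := h 3 4
  refine ⟨t1 + t2 + t3 + t4 + t5 + t6 + t7 + t8 + t9 + t10, ?_⟩
  unfold cnt wsum tupM
  push_cast
  linarith

/-- Total number of ordered differing pairs. -/
def err (w : V → V → ℤ) : ℤ := ∑ x, ∑ y, w x y

lemma err_nonneg (w : V → V → ℤ) (h : ∀ x y, 0 ≤ w x y) : 0 ≤ err w :=
  Finset.sum_nonneg fun x _ => Finset.sum_nonneg fun y _ => h x y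

lemma sum_wsum (w : V → V → ℤ) :
    ∑ v : Fin 5 → V, wsum w v = 10 * (Fintype.card V : ℤ) ^ 3 * err w := by
  have h := sum_tup (fun a b c d e : V => w a b + w a c + w a d + w a e + w b c + w b d
    + w b e + w c d + w c e + w d e)
  have h1 : ∑ v : Fin 5 → V, wsum w v = _ := h
  rw [h1]
  simp only [Finset.sum_add_distrib, Finset.sum_const, Finset.card_univ, nsmul_eq_mul,
    ← Finset.mul_sum]
  unfold err
  ring

lemma sum_eq_wsum (w : V → V → ℤ) (h0 : ∀ x, w x x = 0) :
    ∑ v : Fin 5 → V, (if v 0 = v 1 then wsum w v else 0) =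
      9 * (Fintype.card V : ℤ) ^ 2 * err w := by
  have h := sum_tup (fun a b c d e : V => if a = b then w a b + w a c + w a d + w a e + w b c
    + w b d + w b e + w c d + w c e + w d e else 0)
  have h1 : ∑ v : Fin 5 → V, (if v 0 = v 1 then wsum w v else 0) = _ := h
  rw [h1]
  have h2 : ∀ a b : V, ∑ c, ∑ d, ∑ e, (if a = b then w a b + w a c + w a d + w a e + w b c
    + w b d + w b e + w c d + w c e + w d e else 0) =
    if a = b then ∑ c, ∑ d, ∑ e, (w a b + w a c + w a d + w a e + w b c
    + w b d + w b e + w c d + w c e + w d e) else 0 := by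
    intro a b
    split_ifs <;> simp
  simp only [h2, Finset.sum_ite_eq, Finset.mem_univ, if_true]
  simp only [h0, Finset.sum_add_distrib, Finset.sum_const, Finset.card_univ, nsmul_eq_mul,
    ← Finset.mul_sum]
  unfold err
  ring

lemma sum_noninj (w : V → V → ℤ) (hn : ∀ x y, 0 ≤ w x y) (hw : ∀ x y, w x y = w y x)
    (h0 : ∀ x, w x x = 0) :
    ∑ v : Fin 5 → V, (if Function.Injective v then 0 else wsum w v) ≤
      90 * (Fintype.card V : ℤ) ^ 2 * err w := by
  have hws : ∀ v : Fin 5 → V, 0 ≤ wsum w v := by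
    intro v
    unfold wsum
    linarith [hn (v 0) (v 1), hn (v 0) (v 2), hn (v 0) (v 3), hn (v 0) (v 4), hn (v 1) (v 2),
      hn (v 1) (v 3), hn (v 1) (v 4), hn (v 2) (v 3), hn (v 2) (v 4), hn (v 3) (v 4)]
  have h1 : ∀ v : Fin 5 → V, (if Function.Injective v then 0 else wsum w v) ≤
      ∑ q ∈ (Finset.univ : Finset (Fin 5 × Fin 5)).filter (fun q => q.1 < q.2),
        (if v q.1 = v q.2 then wsum w v else 0) := by
    intro v
    have hpos : ∀ q ∈ (Finset.univ : Finset (Fin 5 × Fin 5)).filter (fun q => q.1 < q.2),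
        0 ≤ (if v q.1 = v q.2 then wsum w v else 0) := by
      intro q _
      split_ifs
      · exact hws v
      · exact le_rfl
    split_ifs with hi
    · exact Finset.sum_nonneg hpos
    · unfold Function.Injective at hi
      push Not at hi
      obtain ⟨a, b, hab, hne⟩ := hi
      rcases lt_or_gt_of_ne hne with hlt | hlt
      · refine le_trans ?_ (Finset.single_le_sum hpos (a := (a, b)) (by simp [hlt]))
        simp [hab]
      · refine le_trans ?_ (Finset.single_le_sum hpos (a := (b, a)) (by simp [hlt]))
        simp [hab]
  refine le_trans (Finset.sum_le_sum fun v _ => h1 v) ?_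
  rw [Finset.sum_comm]
  have h2 : ∀ q ∈ (Finset.univ : Finset (Fin 5 × Fin 5)).filter (fun q => q.1 < q.2),
      ∑ v : Fin 5 → V, (if v q.1 = v q.2 then wsum w v else 0) =
        9 * (Fintype.card V : ℤ) ^ 2 * err w := by
    intro q hq
    obtain ⟨p, hp0, hp1⟩ := exists_perm q.1 q.2 (ne_of_lt (by simpa using hq))
    rw [← sum_eq_wsum w h0, ← sum_perm p p.bijective (fun v => if v 0 = v 1 then wsum w v else 0)]
    simp only [hp0, hp1, wsum_perm w hw h0]
  rw [Finset.sum_congr rfl h2, Finset.sum_const]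
  have h3 : ((Finset.univ : Finset (Fin 5 × Fin 5)).filter (fun q => q.1 < q.2)).card = 10 := by
    decide +kernel
  rw [h3]
  simp only [nsmul_eq_mul]
  push_cast
  linarith

lemma sum_star (w : V → V → ℤ) (hn : ∀ x y, 0 ≤ w x y) :
    ∑ a, (∑ b, w a b) * (∑ c, w a c) ≤ err w ^ 2 := by
  unfold err
  rw [sq, Finset.sum_mul]
  refine Finset.sum_le_sum fun a _ => ?_
  refine mul_le_mul_of_nonneg_left ?_ (Finset.sum_nonneg fun b _ => hn a b)
  exact Finset.single_le_sum (f := fun a => ∑ c, w a c)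
    (fun a _ => Finset.sum_nonneg fun b _ => hn a b) (Finset.mem_univ a)

end Compare

/-! ### Two-clique patterns -/

section Cliques

set_option linter.unusedSectionVars false

variable {V : Type*} [Fintype V]

/-- The (reflexive) union of two cliques given by a colouring. -/
def sc (c : V → Bool) (x y : V) : Bool := c x == c y

/-- The indicator that five coloured points span four edges. -/
def Q (p q s t u : Bool) : ℤ :=
  bif (p == q).toNat + (p == s).toNat + (p == t).toNat + (p == u).toNat + (q == s).toNat
    + (q == t).toNat + (q == u).toNat + (s == t).toNat + (s == u).toNat + (t == u).toNat == 4
  then 1 else 0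

lemma phi_sc (c : V → Bool) (v : Fin 5 → V) :
    phiK (tupM (sc c) v) = Q (c (v 0)) (c (v 1)) (c (v 2)) (c (v 3)) (c (v 4)) := rfl

lemma cnt_sc (c : V → Bool) (v : Fin 5 → V) : cnt (tupM (sc c) v) = 4 ∨
    cnt (tupM (sc c) v) = 6 ∨ cnt (tupM (sc c) v) = 10 := by
  unfold cnt tupM sc
  generalize c (v 0) = p
  generalize c (v 1) = q
  generalize c (v 2) = s
  generalize c (v 3) = t
  generalize c (v 4) = u
  revert p q s t u
  decide

/-- Size of a colour class. -/
def cls (c : V → Bool) (b : Bool) : ℤ := ∑ x, if c x = b then 1 else 0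

lemma cls_nonneg (c : V → Bool) (b : Bool) : 0 ≤ cls c b :=
  Finset.sum_nonneg fun x _ => by split_ifs <;> norm_num

lemma sum_col (c : V → Bool) (f : Bool → ℤ) :
    ∑ x, f (c x) = cls c true * f true + cls c false * f false := by
  unfold cls
  rw [Finset.sum_mul, Finset.sum_mul, ← Finset.sum_add_distrib]
  refine Finset.sum_congr rfl fun x _ => ?_
  cases c x <;> simp

def avg (c : V → Bool) (f : Bool → ℤ) : ℤ := cls c true * f true + cls c false * f false

lemma sum_col' (c : V → Bool) (f : Bool → ℤ) : ∑ x, f (c x) = avg c f := sum_col c f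

lemma cls_add (c : V → Bool) : cls c true + cls c false = Fintype.card V := by
  have h := sum_col c (fun _ => 1)
  simp at h
  linarith

lemma sum_phi_sc (c : V → Bool) :
    ∑ v : Fin 5 → V, phiK (tupM (sc c) v) =
      10 * (cls c true * cls c false) ^ 2 * Fintype.card V := by
  rw [← cls_add c]
  have h := sum_tup (fun a b d e f : V => Q (c a) (c b) (c d) (c e) (c f))
  have h1 : ∑ v : Fin 5 → V, phiK (tupM (sc c) v) = _ := h
  rw [h1]
  have e1 : ∀ p q s t, ∑ f, Q p q s t (c f) = avg c (fun u => Q p q s t u) :=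
    fun p q s t => sum_col' c _
  have e2 : ∀ p q s, ∑ e, avg c (fun u => Q p q s (c e) u) =
      avg c (fun t => avg c (fun u => Q p q s t u)) := fun p q s => sum_col' c (fun t => avg c _)
  have e3 : ∀ p q, ∑ e, avg c (fun t => avg c (fun u => Q p q (c e) t u)) =
      avg c (fun s => avg c (fun t => avg c (fun u => Q p q s t u))) :=
    fun p q => sum_col' c (fun s => avg c (fun t => avg c _))
  have e4 : ∀ p, ∑ e, avg c (fun s => avg c (fun t => avg c (fun u => Q p (c e) s t u))) =
      avg c (fun q => avg c (fun s => avg c (fun t => avg c (fun u => Q p q s t u)))) :=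
    fun p => sum_col' c (fun q => avg c (fun s => avg c (fun t => avg c _)))
  have e5 : ∑ e, avg c (fun q => avg c (fun s => avg c (fun t => avg c
        (fun u => Q (c e) q s t u)))) =
      avg c (fun p => avg c (fun q => avg c (fun s => avg c (fun t => avg c
        (fun u => Q p q s t u))))) :=
    sum_col' c (fun p => avg c (fun q => avg c (fun s => avg c (fun t => avg c _))))
  simp only [e1, e2, e3, e4, e5]
  unfold avg
  simp [Q]
  ring

/-- For a fixed pair, the number of completions to a good tuple. -/
lemma sum_three (c : V → Bool) (p q : Bool) (h1 : (Fintype.card V : ℤ) ≤ 4 * cls c true)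
    (h2 : (Fintype.card V : ℤ) ≤ 4 * cls c false) :
    (Fintype.card V : ℤ) ^ 3 ≤ 64 * ∑ d, ∑ e, ∑ f, Q p q (c d) (c e) (c f) := by
  simp only [fun p q s t => sum_col c (Q p q s t),
    fun p q s => sum_col c (fun t => cls c true * Q p q s t true + cls c false * Q p q s t false),
    fun p q => sum_col c (fun s => cls c true * (cls c true * Q p q s true true +
      cls c false * Q p q s true false) + cls c false * (cls c true * Q p q s false true +
      cls c false * Q p q s false false))]
  have hn : (0 : ℤ) ≤ Fintype.card V := by positivity
  set n : ℤ := (Fintype.card V : ℤ)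
  have ha := cls_nonneg c true
  have hb := cls_nonneg c false
  set a := cls c true
  set b := cls c false
  have e1 : n ^ 3 ≤ (4 * a) ^ 3 := by gcongr
  have e2 : n ^ 3 ≤ (4 * b) ^ 3 := by gcongr
  have p1 : 0 ≤ a * a * b := by positivity
  have p2 : 0 ≤ a * b * b := by positivity
  have e3 : n ^ 3 ≤ (4 * a) * (4 * a) * (4 * b) := by
    calc n ^ 3 = n * n * n := by ring
      _ ≤ _ := by gcongr
  cases p <;> cases q <;> simp [Q] <;> nlinarith

lemma bad_sum (r : V → V → Bool) :
    ∑ v : Fin 5 → V, badK (tupM r v) =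
      (Fintype.card V : ℤ) ^ 2 * ∑ a, err (dif r (sc (r a))) := by
  have h := sum_tup (fun a b c _ _ : V => dif r (sc (r a)) b c)
  have h1 : ∀ v : Fin 5 → V, badK (tupM r v) = dif r (sc (r (v 0))) (v 1) (v 2) := by
    intro v
    unfold badK tupM dif sc
    cases r (v 0) (v 1) <;> cases r (v 0) (v 2) <;> cases r (v 1) (v 2) <;> rfl
  simp only [h1]
  rw [h]
  simp only [Finset.sum_const, Finset.card_univ, nsmul_eq_mul, ← Finset.mul_sum]
  unfold err
  ring

lemma exists_cut [Nonempty V] (r : V → V → Bool) (hr : ∀ x, r x x = true)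
    (hs : ∀ x y, r x y = r y x) : ∃ c : V → Bool,
    40 * ∑ v : Fin 5 → V, phiK (tupM r v) + (Fintype.card V : ℤ) ^ 3 * err (dif r (sc c)) ≤
      25 * (Fintype.card V : ℤ) ^ 5 := by
  obtain ⟨a, -, ha⟩ := Finset.exists_min_image (Finset.univ : Finset V)
    (fun a => err (dif r (sc (r a)))) Finset.univ_nonempty
  refine ⟨r a, ?_⟩
  have h := flag_ineq r hr hs
  rw [bad_sum] at h
  have h2 : (Fintype.card V : ℤ) * err (dif r (sc (r a))) ≤ ∑ a, err (dif r (sc (r a))) := by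
    have := Finset.card_nsmul_le_sum Finset.univ (fun a => err (dif r (sc (r a))))
      (err (dif r (sc (r a)))) ha
    simpa using this
  have h3 := mul_le_mul_of_nonneg_left h2 (by positivity : (0 : ℤ) ≤ (Fintype.card V : ℤ) ^ 2)
  nlinarith

end Cliques

/-! ### The local estimate -/

section Local

set_option linter.unusedSectionVars false

variable {V : Type*} [Fintype V]

lemma cnt_two (r : V → V → Bool) (hr : ∀ x, r x x = true) (hs : ∀ x y, r x y = r y x)
    (v : Fin 5 → V) : ∑ i, ∑ j, (r (v i) (v j)).toNat = 2 * cnt (tupM r v) + 5 := by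
  simp only [Fin.sum_univ_five, hr, cnt, tupM, Bool.toNat_true]
  rw [hs (v 1) (v 0), hs (v 2) (v 0), hs (v 3) (v 0), hs (v 4) (v 0), hs (v 2) (v 1),
    hs (v 3) (v 1), hs (v 4) (v 1), hs (v 3) (v 2), hs (v 4) (v 2), hs (v 4) (v 3)]
  ring

lemma cnt_perm (r : V → V → Bool) (hr : ∀ x, r x x = true) (hs : ∀ x y, r x y = r y x)
    (v : Fin 5 → V) (p : Equiv.Perm (Fin 5)) :
    cnt (tupM r (fun i => v (p i))) = cnt (tupM r v) := by
  have h1 := cnt_two r hr hs (fun i => v (p i))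
  have h2 := cnt_two r hr hs v
  have h3 : ∑ i, ∑ j, (r (v (p i)) (v (p j))).toNat = ∑ i, ∑ j, (r (v i) (v j)).toNat := by
    rw [Equiv.sum_comp p (fun i => ∑ j, (r (v i) (v (p j))).toNat)]
    exact Finset.sum_congr rfl fun i _ => Equiv.sum_comp p (fun j => (r (v i) (v j)).toNat)
  have h4 : ∑ i, ∑ j, (r ((fun i => v (p i)) i) ((fun i => v (p i)) j)).toNat =
    ∑ i, ∑ j, (r (v i) (v j)).toNat := h3
  omega

lemma phi_perm (r : V → V → Bool) (hr : ∀ x, r x x = true) (hs : ∀ x y, r x y = r y x)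
    (v : Fin 5 → V) (p : Equiv.Perm (Fin 5)) :
    phiK (tupM r (fun i => v (p i))) = phiK (tupM r v) := by
  unfold phiK
  rw [cnt_perm r hr hs]

lemma sc_refl (c : V → Bool) (x : V) : sc c x x = true := by simp [sc]

lemma sc_symm (c : V → Bool) (x y : V) : sc c x y = sc c y x := by
  unfold sc
  cases c x <;> cases c y <;> rfl

lemma sum_sym (w : V → V → ℤ) (g : (Fin 5 → V) → ℤ)
    (hg : ∀ v (p : Equiv.Perm (Fin 5)), g (fun i => v (p i)) = g v) :
    ∑ v, wsum w v * g v = 10 * ∑ v : Fin 5 → V, w (v 0) (v 1) * g v := by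
  have h : ∀ k l : Fin 5, k ≠ l → ∑ v : Fin 5 → V, w (v k) (v l) * g v =
      ∑ v : Fin 5 → V, w (v 0) (v 1) * g v := by
    intro k l hkl
    obtain ⟨p, hp0, hp1⟩ := exists_perm k l hkl
    rw [← sum_perm p p.bijective (fun v => w (v 0) (v 1) * g v)]
    simp only [hp0, hp1, hg]
  simp only [wsum, add_mul, Finset.sum_add_distrib]
  rw [h 0 2 (by decide), h 0 3 (by decide), h 0 4 (by decide), h 1 2 (by decide),
    h 1 3 (by decide), h 1 4 (by decide), h 2 3 (by decide), h 2 4 (by decide), h 3 4 (by decide)]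
  ring

lemma phiK_cases (m : Fin 5 → Fin 5 → Bool) :
    (cnt m = 4 ∧ phiK m = 1) ∨ (cnt m ≠ 4 ∧ phiK m = 0) := by
  unfold phiK
  by_cases h : cnt m = 4 <;> simp [h, Bool.cond_eq_ite]

lemma local_pt (r : V → V → Bool) (c : V → Bool) (v : Fin 5 → V) :
    phiK (tupM r v) - phiK (tupM (sc c) v) ≤
      -(wsum (dif r (sc c)) v * phiK (tupM (sc c) v)) +
        2 * (wsum (dif r (sc c)) v * (wsum (dif r (sc c)) v - 1)) := by
  have h1 := phi_diff r (sc c) v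
  obtain ⟨t, ht⟩ := wsum_parity r (sc c) v
  have h2 := cnt_sc c v
  have h3 := phiK_cases (tupM r v)
  have h4 := phiK_cases (tupM (sc c) v)
  generalize wsum (dif r (sc c)) v = W at *
  have hW : 0 ≤ W := by omega
  rcases (by omega : W = 0 ∨ W = 1 ∨ 2 ≤ W) with h | h | h
  · subst h
    simp
    omega
  · subst h
    simp
    omega
  · have h5 : 2 * W ≤ W * W := by nlinarith
    rcases h4 with h4 | h4 <;> rcases h3 with h3 | h3 <;> rw [h3.2, h4.2] <;> linarith

lemma wsum_sq (w : V → V → ℤ) (hn : ∀ x y, 0 ≤ w x y) (hw : ∀ x y, w x y = w y x)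
    (h0 : ∀ x, w x x = 0) (h1 : ∀ x y, w x y = 0 ∨ w x y = 1) :
    ∑ v : Fin 5 → V, wsum w v * (wsum w v - 1) ≤ 90 * (Fintype.card V : ℤ) ^ 2 * err w ^ 2 := by
  rw [sum_sym w (fun v => wsum w v - 1) (fun v p => by rw [wsum_perm w hw h0])]
  have h2 : ∀ v : Fin 5 → V, w (v 0) (v 1) * (wsum w v - 1) =
      w (v 0) (v 1) * w (v 0) (v 2) + w (v 0) (v 1) * w (v 0) (v 3) +
      w (v 0) (v 1) * w (v 0) (v 4) + w (v 1) (v 0) * w (v 1) (v 2) +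
      w (v 1) (v 0) * w (v 1) (v 3) + w (v 1) (v 0) * w (v 1) (v 4) +
      w (v 0) (v 1) * w (v 2) (v 3) + w (v 0) (v 1) * w (v 2) (v 4) +
      w (v 0) (v 1) * w (v 3) (v 4) := by
    intro v
    unfold wsum
    rw [hw (v 1) (v 0)]
    rcases h1 (v 0) (v 1) with h | h <;> rw [h] <;> ring
  simp only [h2]
  have h3 := sum_tup (fun a b d e f : V => w a b * w a d + w a b * w a e + w a b * w a f +
    w b a * w b d + w b a * w b e + w b a * w b f + w a b * w d e + w a b * w d f +
    w a b * w e f)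
  rw [h3]
  have sA := sum_star w hn
  have sB : ∑ a, ∑ b, ∑ d, w b a * w b d ≤ err w ^ 2 := by
    rw [Finset.sum_comm]
    simpa only [← Finset.mul_sum, ← Finset.sum_mul] using sA
  have hE := err_nonneg w hn
  simp only [Finset.sum_add_distrib, Finset.sum_const, Finset.card_univ, nsmul_eq_mul,
    ← Finset.mul_sum, ← Finset.sum_mul] at sB ⊢
  have hc : (0 : ℤ) ≤ (Fintype.card V : ℤ) := by positivity
  have hc1 : (Fintype.card V : ℤ) ≤ (Fintype.card V : ℤ) ^ 2 := by
    rcases Nat.eq_zero_or_pos (Fintype.card V) with h | h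
    · rw [h]; norm_num
    · have : (1 : ℤ) ≤ (Fintype.card V : ℤ) := by exact_mod_cast h
      nlinarith
  change 10 * (_ + _ + _ + _ + _ + _ + _ * (err w * err w) + _ * (err w * err w) +
    _ * (err w * err w)) ≤ _
  generalize err w = e at *
  generalize (Fintype.card V : ℤ) = N at *
  generalize ∑ a, (∑ b, w a b) * ∑ c, w a c = A at *
  generalize ∑ x, ∑ y, w y x * ∑ i, w y i = B at *
  have k1 := mul_le_mul_of_nonneg_left sA (by positivity : 0 ≤ N ^ 2)
  have k2 := mul_le_mul_of_nonneg_left sB (by positivity : 0 ≤ N ^ 2)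
  have k3 := mul_le_mul_of_nonneg_right hc1 (by positivity : 0 ≤ e ^ 2)
  nlinarith

lemma sum_gain (c : V → Bool) (w : V → V → ℤ) (hn : ∀ x y, 0 ≤ w x y)
    (h1 : (Fintype.card V : ℤ) ≤ 4 * cls c true)
    (h2 : (Fintype.card V : ℤ) ≤ 4 * cls c false) :
    (Fintype.card V : ℤ) ^ 3 * err w * 10 ≤
      64 * ∑ v : Fin 5 → V, wsum w v * phiK (tupM (sc c) v) := by
  rw [sum_sym w _ (fun v p => phi_perm (sc c) (sc_refl c) (sc_symm c) v p)]
  have h := sum_tup (fun a b d e f : V => w a b * Q (c a) (c b) (c d) (c e) (c f))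
  have h3 : ∑ v : Fin 5 → V, w (v 0) (v 1) * phiK (tupM (sc c) v) = _ := h
  rw [h3]
  simp only [← Finset.mul_sum]
  have h4 : (Fintype.card V : ℤ) ^ 3 * err w ≤ 64 * ∑ a, ∑ b, w a b *
      ∑ d, ∑ e, ∑ f, Q (c a) (c b) (c d) (c e) (c f) := by
    unfold err
    simp only [Finset.mul_sum (Finset.univ : Finset V) _ ((Fintype.card V : ℤ) ^ 3)]
    rw [Finset.mul_sum (Finset.univ : Finset V) _ (64 : ℤ)]
    refine Finset.sum_le_sum fun a _ => ?_
    rw [Finset.mul_sum (Finset.univ : Finset V) _ (64 : ℤ)]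
    refine Finset.sum_le_sum fun b _ => ?_
    have := mul_le_mul_of_nonneg_left (sum_three c (c a) (c b) h1 h2) (hn a b)
    linarith
  linarith

end Local

/-! ### Injective tuples -/

section Inj

set_option linter.unusedSectionVars false

variable {V : Type*} [Fintype V]

/-- Number of injective good tuples. -/
noncomputable def injSum (r : V → V → Bool) : ℤ :=
  ∑ v : Fin 5 → V, if Function.Injective v then phiK (tupM r v) else 0

lemma wsum_nonneg (w : V → V → ℤ) (hn : ∀ x y, 0 ≤ w x y) (v : Fin 5 → V) : 0 ≤ wsum w v := by
  unfold wsum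
  linarith [hn (v 0) (v 1), hn (v 0) (v 2), hn (v 0) (v 3), hn (v 0) (v 4), hn (v 1) (v 2),
      hn (v 1) (v 3), hn (v 1) (v 4), hn (v 2) (v 3), hn (v 2) (v 4), hn (v 3) (v 4)]

lemma phiK_nonneg (m : Fin 5 → Fin 5 → Bool) : 0 ≤ phiK m := by
  rcases phiK_cases m with h | h <;> rw [h.2] <;> norm_num

lemma injSum_le (r : V → V → Bool) : injSum r ≤ ∑ v : Fin 5 → V, phiK (tupM r v) := by
  refine Finset.sum_le_sum fun v _ => ?_
  split_ifs
  · exact le_rfl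
  · exact phiK_nonneg _

lemma injSum_diff1 (r s : V → V → Bool) :
    injSum r ≤ injSum s + 10 * (Fintype.card V : ℤ) ^ 3 * err (dif r s) := by
  rw [← sum_wsum]
  unfold injSum
  rw [← Finset.sum_add_distrib]
  refine Finset.sum_le_sum fun v _ => ?_
  have h := (phi_diff r s v).1
  have h2 := wsum_nonneg _ (dif_nonneg r s) v
  split_ifs <;> linarith

lemma dif_symm (r s : V → V → Bool) (hr : ∀ x y, r x y = r y x) (hs : ∀ x y, s x y = s y x)
    (x y : V) : dif r s x y = dif r s y x := by
  unfold dif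
  rw [hr, hs]

lemma dif_self (r s : V → V → Bool) (hr : ∀ x, r x x = true) (hs : ∀ x, s x x = true)
    (x : V) : dif r s x x = 0 := by
  unfold dif
  rw [hr, hs]
  rfl

lemma injSum_diff2 (r s : V → V → Bool) (hr : ∀ x, r x x = true) (hrs : ∀ x y, r x y = r y x)
    (hs : ∀ x, s x x = true) (hss : ∀ x y, s x y = s y x) :
    injSum r ≤ injSum s + (∑ v : Fin 5 → V, (phiK (tupM r v) - phiK (tupM s v))) +
      90 * (Fintype.card V : ℤ) ^ 2 * err (dif r s) := by
  have h := sum_noninj (dif r s) (dif_nonneg r s) (dif_symm r s hrs hss) (dif_self r s hr hs)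
  refine le_trans ?_ (add_le_add_right h _)
  unfold injSum
  rw [← Finset.sum_add_distrib, ← Finset.sum_add_distrib]
  refine Finset.sum_le_sum fun v _ => ?_
  have h := (phi_diff r s v).2
  split_ifs <;> linarith

lemma injSum_diff3 (r : V → V → Bool) (c : V → Bool) (hr : ∀ x, r x x = true)
    (hrs : ∀ x y, r x y = r y x) (h1 : (Fintype.card V : ℤ) ≤ 4 * cls c true)
    (h2 : (Fintype.card V : ℤ) ≤ 4 * cls c false) :
    64 * injSum r ≤ 64 * injSum (sc c) - 10 * (Fintype.card V : ℤ) ^ 3 * err (dif r (sc c)) +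
      64 * (180 * (Fintype.card V : ℤ) ^ 2 * err (dif r (sc c)) ^ 2 +
      90 * (Fintype.card V : ℤ) ^ 2 * err (dif r (sc c))) := by
  have h := injSum_diff2 r (sc c) hr hrs (sc_refl c) (sc_symm c)
  have g := sum_gain c (dif r (sc c)) (dif_nonneg _ _) h1 h2
  have q := wsum_sq (dif r (sc c)) (dif_nonneg _ _) (dif_symm _ _ hrs (sc_symm c))
    (dif_self _ _ hr (sc_refl c)) (dif_cases _ _)
  have k : ∑ v : Fin 5 → V, (phiK (tupM r v) - phiK (tupM (sc c) v)) ≤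
      -(∑ v : Fin 5 → V, wsum (dif r (sc c)) v * phiK (tupM (sc c) v)) +
        2 * ∑ v : Fin 5 → V, wsum (dif r (sc c)) v * (wsum (dif r (sc c)) v - 1) := by
    rw [← Finset.sum_neg_distrib, Finset.mul_sum, ← Finset.sum_add_distrib]
    exact Finset.sum_le_sum fun v _ => local_pt r c v
  linarith

lemma sum_avoid (c : V → Bool) (f : Bool → ℤ) (S : List V) (hS : S.Nodup) :
    ∑ x, (if x ∉ S then f (c x) else 0) = avg c f - (S.map (fun x => f (c x))).sum := by
  rw [← sum_col']
  have h : ∑ x, (if x ∈ S then f (c x) else 0) = (S.map (fun x => f (c x))).sum := by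
    rw [← List.sum_toFinset _ hS, ← Finset.sum_filter]
    refine Finset.sum_congr ?_ fun _ _ => rfl
    ext x
    simp
  rw [← h, ← Finset.sum_sub_distrib]
  refine Finset.sum_congr rfl fun x _ => ?_
  by_cases hx : x ∈ S <;> simp [hx]

lemma inj_iff (v : Fin 5 → V) : Function.Injective v ↔
    v 1 ∉ [v 0] ∧ v 2 ∉ [v 0, v 1] ∧ v 3 ∉ [v 0, v 1, v 2] ∧ v 4 ∉ [v 0, v 1, v 2, v 3] := by
  constructor
  · intro h
    simp [h.eq_iff]
  · rintro h a b hab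
    simp at h
    fin_cases a <;> fin_cases b <;> simp at hab ⊢ <;> grind

def g4 (c : V → Bool) (p q s t : Bool) : ℤ :=
  avg c (Q p q s t) - (Q p q s t p + (Q p q s t q + (Q p q s t s + Q p q s t t)))
def g3 (c : V → Bool) (p q s : Bool) : ℤ :=
  avg c (g4 c p q s) - (g4 c p q s p + (g4 c p q s q + g4 c p q s s))
def g2 (c : V → Bool) (p q : Bool) : ℤ := avg c (g3 c p q) - (g3 c p q p + g3 c p q q)
def g1 (c : V → Bool) (p : Bool) : ℤ := avg c (g2 c p) - g2 c p p

lemma injSum_eq (c : V → Bool) : injSum (sc c) = avg c (g1 c) := by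
  have h := sum_tup (fun a b d e f : V => if b ∉ [a] then if d ∉ [a, b] then
    if e ∉ [a, b, d] then if f ∉ [a, b, d, e] then Q (c a) (c b) (c d) (c e) (c f)
    else 0 else 0 else 0 else 0)
  have h1 : injSum (sc c) = ∑ v : Fin 5 → V, if v 1 ∉ [v 0] then if v 2 ∉ [v 0, v 1] then
      if v 3 ∉ [v 0, v 1, v 2] then if v 4 ∉ [v 0, v 1, v 2, v 3] then
      Q (c (v 0)) (c (v 1)) (c (v 2)) (c (v 3)) (c (v 4)) else 0 else 0 else 0 else 0 := by
    unfold injSum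
    refine Finset.sum_congr rfl fun v _ => ?_
    rw [phi_sc]
    simp only [inj_iff, ite_and]
  rw [h1, h]
  have push : ∀ (P : Prop) [Decidable P] (g : V → ℤ),
      ∑ x, (if P then g x else 0) = if P then ∑ x, g x else 0 := by
    intro P _ g
    split_ifs <;> simp
  simp only [push]
  rw [← sum_col']
  refine Finset.sum_congr rfl fun a _ => ?_
  have e1 := sum_avoid c (g2 c (c a)) [a] (by simp)
  simp only [List.map_cons, List.map_nil, List.sum_cons, List.sum_nil, add_zero] at e1
  refine Eq.trans (Finset.sum_congr rfl fun b _ => ?_) e1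
  refine ite_congr rfl (fun hb => ?_) fun _ => rfl
  have e2 := sum_avoid c (g3 c (c a) (c b)) [a, b] (by simp at hb ⊢; grind)
  simp only [List.map_cons, List.map_nil, List.sum_cons, List.sum_nil, add_zero] at e2
  refine Eq.trans (Finset.sum_congr rfl fun d _ => ?_) e2
  refine ite_congr rfl (fun hd => ?_) fun _ => rfl
  have e3 := sum_avoid c (g4 c (c a) (c b) (c d)) [a, b, d] (by simp at hb hd ⊢; grind)
  simp only [List.map_cons, List.map_nil, List.sum_cons, List.sum_nil, add_zero] at e3
  refine Eq.trans (Finset.sum_congr rfl fun e _ => ?_) e3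
  refine ite_congr rfl (fun he => ?_) fun _ => rfl
  have e4 := sum_avoid c (Q (c a) (c b) (c d) (c e)) [a, b, d, e]
    (by simp at hb hd he ⊢; grind)
  simp only [List.map_cons, List.map_nil, List.sum_cons, List.sum_nil, add_zero] at e4
  exact e4

lemma injSum_sc (c : V → Bool) : injSum (sc c) =
    10 * (cls c true * cls c false) * (cls c true * cls c false - Fintype.card V + 1) *
      (Fintype.card V - 4) := by
  rw [← cls_add c, injSum_eq]
  simp [g1, g2, g3, g4, avg, Q]
  ring

end Inj

/-! ### Relation to the counting functions -/

section Count

variable {n : ℕ}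

/-- The reflexive closure of adjacency as a Boolean relation. -/
noncomputable def relG (G : SimpleGraph (Fin n)) (x y : Fin n) : Bool := decide (x = y ∨ G.Adj x y)

lemma relG_refl (G : SimpleGraph (Fin n)) (x : Fin n) : relG G x x = true := by simp [relG]

lemma relG_symm (G : SimpleGraph (Fin n)) (x y : Fin n) : relG G x y = relG G y x := by
  unfold relG
  exact decide_eq_decide.mpr (or_congr eq_comm (G.adj_comm x y))

lemma edgeCount_two (G : SimpleGraph (Fin n)) (S : Finset (Fin n)) :
    ∑ x ∈ S, ∑ y ∈ S, (if G.Adj x y then (1 : ℤ) else 0) = 2 * edgeCount G S := by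
  have h1 : (edgeCount G S : ℤ) = ∑ x ∈ S, ∑ y ∈ S, (if x < y ∧ G.Adj x y then (1 : ℤ) else 0) := by
    unfold edgeCount
    rw [← Finset.sum_product', Finset.card_filter, ← Finset.sum_filter_add_sum_filter_not
      Finset.univ (fun p : Fin n × Fin n => p.1 ∈ S ∧ p.2 ∈ S)]
    push_cast
    rw [Finset.sum_eq_zero (s := Finset.filter (fun p : Fin n × Fin n => ¬(p.1 ∈ S ∧ p.2 ∈ S)) _),
      add_zero]
    · refine Finset.sum_congr ?_ ?_
      · ext p
        simp
      · intro p hp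
        simp at hp
        simp [hp]
    · intro p hp
      simp at hp
      rw [if_neg]
      tauto
  have h2 : (edgeCount G S : ℤ) = ∑ x ∈ S, ∑ y ∈ S, (if y < x ∧ G.Adj x y then (1 : ℤ) else 0) := by
    rw [h1, Finset.sum_comm]
    simp only [G.adj_comm]
  have h3 : (2 * edgeCount G S : ℤ) = edgeCount G S + edgeCount G S := by ring
  rw [h3]
  nth_rewrite 1 [h1]
  rw [h2, ← Finset.sum_add_distrib]
  refine Finset.sum_congr rfl fun x _ => ?_
  rw [← Finset.sum_add_distrib]
  refine Finset.sum_congr rfl fun y _ => ?_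
  rcases lt_trichotomy x y with h | h | h
  · simp [h, h.not_gt]
  · simp [h]
  · simp [h, h.not_gt]

lemma edgeCount_image (G : SimpleGraph (Fin n)) (v : Fin 5 → Fin n) (hv : Function.Injective v) :
    edgeCount G (Finset.univ.image v) = cnt (tupM (relG G) v) := by
  have h1 := edgeCount_two G (Finset.univ.image v)
  rw [Finset.sum_image hv.injOn] at h1
  simp only [Finset.sum_image hv.injOn] at h1
  have h2 := wsum_two (fun x y => if G.Adj x y then (1 : ℤ) else 0)
    (fun x y => by simp only [G.adj_comm]) (fun x => by simp) v
  have h3 : wsum (fun x y => if G.Adj x y then (1 : ℤ) else 0) v = cnt (tupM (relG G) v) := by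
    have h4 : ∀ i j, i ≠ j → (if G.Adj (v i) (v j) then (1 : ℤ) else 0) =
        (relG G (v i) (v j)).toNat := by
      intro i j hij
      by_cases h : G.Adj (v i) (v j) <;> simp [relG, h, hv.eq_iff, hij]
    unfold wsum cnt tupM
    push_cast
    rw [h4 0 1 (by decide), h4 0 2 (by decide), h4 0 3 (by decide), h4 0 4 (by decide),
      h4 1 2 (by decide), h4 1 3 (by decide), h4 1 4 (by decide), h4 2 3 (by decide),
      h4 2 4 (by decide), h4 3 4 (by decide)]
  rw [h3] at h2
  have h5 := h1.symm.trans h2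
  omega

lemma card_fiber (S : Finset (Fin n)) (hS : S.card = 5) :
    (Finset.univ.filter (fun v : Fin 5 → Fin n =>
      Function.Injective v ∧ Finset.univ.image v = S)).card = 120 := by
  have h : (Finset.univ : Finset (Equiv.Perm (Fin 5))).card = 120 := by
    rw [Finset.card_univ, Fintype.card_perm, Fintype.card_fin]
    rfl
  rw [← h]
  symm
  let e := S.orderEmbOfFin hS
  have he : Finset.univ.image e = S := by
    simp [e]
  refine Finset.card_bij (fun σ _ => fun i => e (σ i)) ?_ ?_ ?_
  · intro σ _
    simp only [Finset.mem_filter, Finset.mem_univ, true_and]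
    refine ⟨e.injective.comp σ.injective, ?_⟩
    rw [← he]
    ext x
    simp only [Finset.mem_image, Finset.mem_univ, true_and]
    constructor
    · rintro ⟨i, hi⟩
      exact ⟨σ i, hi⟩
    · rintro ⟨i, hi⟩
      exact ⟨σ.symm i, by simpa using hi⟩
  · intro σ _ τ _ hst
    ext i
    have := congrFun hst i
    exact congrArg _ (e.injective this)
  · intro v hv
    simp only [Finset.mem_filter, Finset.mem_univ, true_and] at hv
    have hm : ∀ i, ∃ j, e j = v i := by
      intro i
      have : v i ∈ Finset.univ.image e := by
        rw [he, ← hv.2]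
        exact Finset.mem_image_of_mem _ (Finset.mem_univ i)
      simpa using this
    choose f hf using hm
    have hfi : Function.Injective f := by
      intro i j hij
      apply hv.1
      rw [← hf, ← hf, hij]
    refine ⟨Equiv.ofBijective f (Finite.injective_iff_bijective.mp hfi), Finset.mem_univ _, ?_⟩
    funext i
    exact hf i

lemma injSum_relG (G : SimpleGraph (Fin n)) : injSum (relG G) = 120 * numKL 5 4 G := by
  have h0 : injSum (relG G) = ∑ v ∈ Finset.univ.filter
      (fun v : Fin 5 → Fin n => Function.Injective v), phiK (tupM (relG G) v) := by
    unfold injSum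
    rw [Finset.sum_filter]
    refine Finset.sum_congr rfl fun v _ => ?_
    by_cases hv : Function.Injective v <;> simp [hv]
  rw [h0]
  unfold numKL
  have hmap : ∀ v ∈ Finset.univ.filter (fun v : Fin 5 → Fin n => Function.Injective v),
      Finset.univ.image v ∈ Finset.powersetCard 5 (Finset.univ : Finset (Fin n)) := by
    intro v hv
    rw [Finset.mem_powersetCard]
    refine ⟨Finset.subset_univ _, ?_⟩
    rw [Finset.card_image_of_injective _ (by simpa using hv)]
    simp
  rw [← Finset.sum_fiberwise_of_maps_to hmap, Finset.card_filter]
  push_cast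
  rw [Finset.mul_sum]
  refine Finset.sum_congr rfl fun S hS => ?_
  rw [Finset.mem_powersetCard] at hS
  have h1 : ∀ v ∈ (Finset.univ.filter (fun v : Fin 5 → Fin n => Function.Injective v)).filter
      (fun v => Finset.univ.image v = S), phiK (tupM (relG G) v) =
        if edgeCount G S = 4 then 1 else 0 := by
    intro v hv
    simp only [Finset.mem_filter, Finset.mem_univ, true_and] at hv
    rw [← hv.2, edgeCount_image G v hv.1]
    unfold phiK
    rw [Bool.cond_eq_ite]
    simp
  rw [Finset.sum_congr rfl h1, Finset.sum_const, Finset.filter_filter, card_fiber S hS.2]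
  simp

end Count

/-! ### Two-clique graphs and the edit distance -/

section Final

variable {n : ℕ}

/-- The union of two cliques given by a colouring. -/
def gr (c : Fin n → Bool) : SimpleGraph (Fin n) where
  Adj u v := u ≠ v ∧ c u = c v
  symm := ⟨fun _ _ h => ⟨h.1.symm, h.2.symm⟩⟩
  loopless := ⟨fun _ h => h.1 rfl⟩

lemma relG_gr (c : Fin n → Bool) : relG (gr c) = sc c := by
  funext x y
  unfold relG sc gr
  by_cases h : x = y
  · simp [h]
  · by_cases h2 : c x = c y <;> simp [h, h2]

lemma gr_two (c : Fin n → Bool) : isTwoCliques (gr c) := by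
  refine ⟨fun u => if c u then 1 else 0, fun u v => ?_⟩
  unfold gr
  cases hu : c u <;> cases hv : c v <;> simp [hu, hv]

lemma dist_le (G : SimpleGraph (Fin n)) (c : Fin n → Bool) :
    (distToFam G isTwoCliques : ℤ) ≤ err (dif (relG G) (sc c)) := by
  have h1 : distToFam G isTwoCliques ≤ editDist G (gr c) :=
    ciInf_le (OrderBot.bddBelow _)
      (⟨gr c, gr_two c⟩ : {H : SimpleGraph (Fin n) // isTwoCliques H})
  have h2 : editDist G (gr c) ≤ (Finset.univ.filter (fun p : Fin n × Fin n =>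
      p.1 < p.2 ∧ ¬ (G.Adj p.1 p.2 ↔ (gr c).Adj p.1 p.2))).card :=
    ciInf_le (OrderBot.bddBelow _) (Equiv.refl (Fin n))
  have h3 : ((Finset.univ.filter (fun p : Fin n × Fin n =>
      p.1 < p.2 ∧ ¬ (G.Adj p.1 p.2 ↔ (gr c).Adj p.1 p.2))).card : ℤ) ≤
      err (dif (relG G) (sc c)) := by
    unfold err
    rw [← Finset.sum_product', Finset.card_filter]
    push_cast
    refine Finset.sum_le_sum fun p _ => ?_
    split_ifs with h
    · rw [← relG_gr]
      have : relG G p.1 p.2 ≠ relG (gr c) p.1 p.2 := by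
        unfold relG
        intro h4
        rw [decide_eq_decide] at h4
        have := h.1.ne
        tauto
      unfold dif
      rw [beq_eq_false_iff_ne.mpr this]
      rfl
    · exact dif_nonneg _ _ _ _
  have h4 : (distToFam G isTwoCliques : ℤ) ≤ (Finset.univ.filter (fun p : Fin n × Fin n =>
      p.1 < p.2 ∧ ¬ (G.Adj p.1 p.2 ↔ (gr c).Adj p.1 p.2))).card := by
    exact_mod_cast h1.trans h2
  exact h4.trans h3

/-- The balanced colouring. -/
def cb (n : ℕ) (x : Fin n) : Bool := decide ((x : ℕ) < n / 2)

lemma cls_cb : cls (cb n) true = (n / 2 : ℕ) := by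
  unfold cls cb
  simp only [decide_eq_true_eq]
  rw [Fin.sum_univ_eq_sum_range (fun i => if i < n / 2 then (1 : ℤ) else 0) n,
    ← Finset.sum_filter]
  have : (Finset.range n).filter (fun i => i < n / 2) = Finset.range (n / 2) := by
    ext i
    simp
    omega
  rw [this]
  simp

/-- Product of the class sizes for the balanced colouring. -/
lemma pb_bounds : (n : ℤ) ^ 2 - 1 ≤ 4 * (cls (cb n) true * cls (cb n) false) ∧
    4 * (cls (cb n) true * cls (cb n) false) ≤ (n : ℤ) ^ 2 := by
  have h := cls_add (cb n)
  rw [Fintype.card_fin, cls_cb] at h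
  rw [cls_cb]
  have h2 : cls (cb n) false = n - (n / 2 : ℕ) := by linarith
  rw [h2]
  have h3 : (n : ℤ) = 2 * (n / 2 : ℕ) ∨ (n : ℤ) = 2 * (n / 2 : ℕ) + 1 := by omega
  generalize ((n / 2 : ℕ) : ℤ) = m at *
  rcases h3 with h3 | h3 <;> rw [h3] <;> constructor <;> nlinarith

lemma arith (n a b P E X : ℤ) (F : ℤ) (hn : 1000000 ≤ n) (ha : 0 ≤ a) (hb : 0 ≤ b)
    (hab : a + b = n) (hE : 0 ≤ E) (hP1 : n ^ 2 - 1 ≤ 4 * P) (hP2 : 4 * P ≤ n ^ 2)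
    (h1 : X ≤ 10 * (a * b) * (a * b - n + 1) * (n - 4) + 10 * n ^ 3 * E)
    (hF : 40 * F + n ^ 3 * E ≤ 25 * n ^ 5)
    (h2 : X ≤ 10 * (a * b) * (a * b - n + 1) * (n - 4) + (F - 10 * (a * b) ^ 2 * n) +
      90 * n ^ 2 * E)
    (h3 : n ≤ 4 * a → n ≤ 4 * b → 64 * X ≤ 64 * (10 * (a * b) * (a * b - n + 1) * (n - 4)) -
      10 * n ^ 3 * E + 64 * (180 * n ^ 2 * E ^ 2 + 90 * n ^ 2 * E)) :
    200 * X + n ^ 3 * E ≤ 200 * (10 * P * (P - n + 1) * (n - 4)) := by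
  obtain ⟨p, hp⟩ : ∃ p, p = a * b := ⟨_, rfl⟩
  have hp0 : 0 ≤ p := by rw [hp]; positivity
  have hp4 : 4 * p ≤ n ^ 2 := by
    rw [hp, ← hab]
    nlinarith [sq_nonneg (a - b)]
  have hd : 0 ≤ P - p := by omega
  have hn3 : 0 ≤ n ^ 3 := by positivity
  have hn2 : 0 ≤ n ^ 2 := by positivity
  have hnn : 1000000 * n ≤ n ^ 2 := by nlinarith
  have hnE : 0 ≤ n ^ 3 * E := by positivity
  have hn2E : 1000000 * (n ^ 2 * E) ≤ n ^ 3 * E := by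
    have : 0 ≤ (n - 1000000) * (n ^ 2 * E) := mul_nonneg (by linarith) (by positivity)
    nlinarith
  rw [← hp] at h1 h2 h3
  have key : 10 * P * (P - n + 1) * (n - 4) = 10 * p * (p - n + 1) * (n - 4) +
      10 * (n - 4) * (P - p) * (P + p - n + 1) := by ring
  have gap : 2 * n ^ 3 * (P - p) ≤ 10 * (n - 4) * (P - p) * (P + p - n + 1) := by
    have k1 : 24 * n ^ 2 ≤ 100 * (P + p - n + 1) := by nlinarith
    have k2 : 9 * n ≤ 10 * (n - 4) := by linarith
    have k3 : (9 * n) * (24 * n ^ 2) ≤ (10 * (n - 4)) * (100 * (P + p - n + 1)) :=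
      mul_le_mul k2 k1 (by positivity) (by linarith)
    have k4 := mul_le_mul_of_nonneg_right k3 hd
    nlinarith [mul_nonneg hn3 hd]
  by_cases c1 : 6 * E ≤ P - p
  · have := mul_le_mul_of_nonneg_left c1 hn3
    nlinarith
  push Not at c1
  by_cases c2 : 6000 * E ≤ n
  · have hbal : n ≤ 4 * a ∧ n ≤ 4 * b := by
      have hbig : 3 * n ^ 2 < 16 * p := by nlinarith
      constructor
      · by_contra hlt
        push Not at hlt
        nlinarith
      · by_contra hlt
        push Not at hlt
        nlinarith
    have h4 := h3 hbal.1 hbal.2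
    have h5 : 6000 * (n ^ 2 * E ^ 2) ≤ n ^ 3 * E := by
      have := mul_le_mul_of_nonneg_left c2 (by positivity : 0 ≤ n ^ 2 * E)
      nlinarith
    nlinarith [mul_nonneg hn3 hd]
  · push Not at c2
    have hE1 : 160 ≤ E := by omega
    have h4 : 160 * n ^ 3 ≤ n ^ 3 * E := by
      have := mul_le_mul_of_nonneg_left hE1 hn3
      linarith
    have h5 : (n ^ 2 - 1) ^ 2 ≤ (4 * P) ^ 2 := by
      have : 0 ≤ n ^ 2 - 1 := by linarith
      gcongr
    have h6 : n * (n ^ 2 - 1) ^ 2 ≤ n * (4 * P) ^ 2 :=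
      mul_le_mul_of_nonneg_left h5 (by linarith)
    have h7 : 10 * p * (p - n + 1) * (n - 4) - 10 * p ^ 2 * n -
        (10 * P * (P - n + 1) * (n - 4) - 10 * P ^ 2 * n) =
        10 * (P - p) * (4 * (P + p) + n ^ 2 - 5 * n + 4) := by ring
    have h8 : 4 * (P + p) + n ^ 2 - 5 * n + 4 ≤ 3 * n ^ 2 := by linarith
    have h9 : 10 * (P - p) * (4 * (P + p) + n ^ 2 - 5 * n + 4) ≤ 10 * (P - p) * (3 * n ^ 2) :=
      mul_le_mul_of_nonneg_left h8 (by linarith)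
    have h10 : (P - p) * n ^ 2 ≤ 6 * E * n ^ 2 := mul_le_mul_of_nonneg_right c1.le hn2
    nlinarith

lemma lamKL_le_max (G : SimpleGraph (Fin n)) : lamKL 5 4 G ≤ lamKLmax 5 4 n :=
  le_ciSup (Set.finite_range _).bddAbove G

lemma num_cb : (120 * numKL 5 4 (gr (cb n)) : ℤ) =
    10 * (cls (cb n) true * cls (cb n) false) * (cls (cb n) true * cls (cb n) false - n + 1) *
      (n - 4) := by
  rw [← injSum_relG, relG_gr, injSum_sc, Fintype.card_fin]

lemma main_int (hn : 1000000 ≤ n) (G : SimpleGraph (Fin n)) :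
    (200 * (120 * numKL 5 4 G) + n ^ 3 * distToFam G isTwoCliques : ℤ) ≤
      200 * (120 * numKL 5 4 (gr (cb n))) := by
  have : Nonempty (Fin n) := ⟨⟨0, by omega⟩⟩
  obtain ⟨c, hc⟩ := exists_cut (relG G) (relG_refl G) (relG_symm G)
  have h1 := injSum_diff1 (relG G) (sc c)
  have h2 := injSum_diff2 (relG G) (sc c) (relG_refl G) (relG_symm G) (sc_refl c) (sc_symm c)
  have h3 := injSum_diff3 (relG G) c (relG_refl G) (relG_symm G)
  rw [Finset.sum_sub_distrib, sum_phi_sc] at h2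
  rw [injSum_sc] at h1 h2 h3
  have hab := cls_add c
  rw [Fintype.card_fin] at *
  have hE := err_nonneg _ (dif_nonneg (relG G) (sc c))
  have hP := pb_bounds (n := n)
  have h := arith n (cls c true) (cls c false) (cls (cb n) true * cls (cb n) false)
    (err (dif (relG G) (sc c))) (injSum (relG G)) _ (by exact_mod_cast hn) (cls_nonneg c true)
    (cls_nonneg c false) hab hE hP.1 hP.2 h1 hc h2 h3
  rw [num_cb, ← injSum_relG]
  have hd := mul_le_mul_of_nonneg_left (dist_le G c) (by positivity : (0 : ℤ) ≤ (n : ℤ) ^ 3)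
  linarith

lemma choose_bounds (hn : 5 ≤ n) : (n : ℝ) ^ 5 - 10 * n ^ 4 ≤ 120 * (n.choose 5 : ℝ) ∧
    120 * (n.choose 5 : ℝ) ≤ (n : ℝ) ^ 5 := by
  have h1 : 120 * n.choose 5 = n.descFactorial 5 := by
    rw [Nat.descFactorial_eq_factorial_mul_choose]
    rfl
  have h2 : 120 * (n.choose 5 : ℝ) = (n.descFactorial 5 : ℕ) := by
    rw [← h1]
    push_cast
    ring
  rw [h2]
  obtain ⟨m, rfl⟩ : ∃ m, n = m + 4 := ⟨n - 4, by omega⟩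
  have h3 : (m + 4).descFactorial 5 = (m + 4) * (m + 3) * (m + 2) * (m + 1) * m := by
    simp [Nat.descFactorial]
    ring
  rw [h3]
  push_cast
  have hm : (0 : ℝ) ≤ m := by positivity
  generalize (m : ℝ) = x at *
  constructor
  · have : 0 ≤ (x + 4) * (x + 3) * (x + 2) * (x + 1) * x - ((x + 4) ^ 5 - 10 * (x + 4) ^ 4) := by
      ring_nf
      positivity
    linarith
  · have : 0 ≤ (x + 4) ^ 5 - (x + 4) * (x + 3) * (x + 2) * (x + 1) * x := by
      ring_nf
      positivity
    linarith

lemma stable (hn : 1000000 ≤ n) (G : SimpleGraph (Fin n)) :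
    (distToFam G isTwoCliques : ℝ) ≤ 1000000 * (lamKLmax 5 4 n - lamKL 5 4 G) * n ^ 2 := by
  have h1 : (200 * (120 * numKL 5 4 G) + n ^ 3 * distToFam G isTwoCliques : ℝ) ≤
      200 * (120 * numKL 5 4 (gr (cb n))) := by exact_mod_cast main_int hn G
  have h2 := lamKL_le_max (gr (cb n))
  have h3 := lamKL_le_max G
  have hC := (choose_bounds (n := n) (by omega)).2
  have hCpos : (0 : ℝ) < n.choose 5 := by
    exact_mod_cast Nat.choose_pos (by omega)
  have hnpos : (0 : ℝ) < n := by
    have : 0 < n := by omega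
    exact_mod_cast this
  have e1 : (numKL 5 4 G : ℝ) = lamKL 5 4 G * n.choose 5 := by
    unfold lamKL
    field_simp
  have e2 : (numKL 5 4 (gr (cb n)) : ℝ) = lamKL 5 4 (gr (cb n)) * n.choose 5 := by
    unfold lamKL
    field_simp
  rw [e1, e2] at h1
  set D : ℝ := (distToFam G isTwoCliques : ℝ)
  set μ := lamKLmax 5 4 n
  set l := lamKL 5 4 G
  have h4 : (n : ℝ) ^ 3 * D ≤ 200 * (μ - l) * (120 * n.choose 5) := by nlinarith
  have h5 : 200 * (μ - l) * (120 * n.choose 5) ≤ 200 * (μ - l) * (n : ℝ) ^ 5 :=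
    mul_le_mul_of_nonneg_left hC (by linarith)
  have h6 : (n : ℝ) ^ 3 * D ≤ (n : ℝ) ^ 3 * (200 * (μ - l) * n ^ 2) := by
    calc _ ≤ _ := h4.trans h5
      _ = _ := by ring
  have h7 := le_of_mul_le_mul_left h6 (by positivity)
  have h8 : 0 ≤ (μ - l) * n ^ 2 := mul_nonneg (by linarith) (by positivity)
  linarith

lemma lam_upper (hn : 100 ≤ n) : lamKLmax 5 4 n ≤ 5 / 8 + 100 / n := by
  refine ciSup_le fun G => ?_
  have : Nonempty (Fin n) := ⟨⟨0, by omega⟩⟩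
  obtain ⟨c, hc⟩ := exists_cut (relG G) (relG_refl G) (relG_symm G)
  have hE := err_nonneg _ (dif_nonneg (relG G) (sc c))
  have h1 := injSum_le (relG G)
  rw [injSum_relG] at h1
  rw [Fintype.card_fin] at hc
  have h2 : (40 * (120 * numKL 5 4 G) : ℤ) ≤ 25 * (n : ℤ) ^ 5 := by
    have : 0 ≤ (n : ℤ) ^ 3 * err (dif (relG G) (sc c)) := by positivity
    linarith
  have h3 : (40 * (120 * numKL 5 4 G) : ℝ) ≤ 25 * (n : ℝ) ^ 5 := by exact_mod_cast h2
  have hC := (choose_bounds (n := n) (by omega)).1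
  have hCpos : (0 : ℝ) < n.choose 5 := by
    exact_mod_cast Nat.choose_pos (by omega)
  have hn' : (100 : ℝ) ≤ n := by exact_mod_cast hn
  unfold lamKL
  rw [div_le_iff₀ hCpos]
  have h4 : (5 / 8 + 100 / n) * ((n : ℝ) ^ 5 - 10 * n ^ 4) ≤
      (5 / 8 + 100 / n) * (120 * (n.choose 5 : ℝ)) :=
    mul_le_mul_of_nonneg_left hC (by positivity)
  have h5 : (5 / 8 + 100 / n) * ((n : ℝ) ^ 5 - 10 * n ^ 4) =
      5 / 8 * n ^ 5 + (100 - 50 / 8) * n ^ 4 - 1000 * n ^ 3 := by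
    have : (n : ℝ) ≠ 0 := by positivity
    field_simp
    ring
  have h6 : (100 : ℝ) * n ^ 3 ≤ n ^ 4 := by
    have := mul_le_mul_of_nonneg_left hn' (by positivity : (0 : ℝ) ≤ n ^ 3)
    nlinarith
  have h7 : (0 : ℝ) ≤ n ^ 3 := by positivity
  nlinarith

lemma lam_lower (hn : 100 ≤ n) : 5 / 8 - 100 / n ≤ lamKLmax 5 4 n := by
  refine le_trans ?_ (lamKL_le_max (gr (cb n)))
  have hP := pb_bounds (n := n)
  have h1 := num_cb (n := n)
  generalize cls (cb n) true * cls (cb n) false = P at *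
  have hn' : (100 : ℝ) ≤ n := by exact_mod_cast hn
  have hP1 : (n : ℝ) ^ 2 - 1 ≤ 4 * P := by exact_mod_cast hP.1
  have h1' : (120 * numKL 5 4 (gr (cb n)) : ℝ) = 10 * P * (P - n + 1) * (n - 4) := by
    exact_mod_cast h1
  have hC := (choose_bounds (n := n) (by omega)).2
  have hCpos : (0 : ℝ) < n.choose 5 := by
    exact_mod_cast Nat.choose_pos (by omega)
  unfold lamKL
  rw [le_div_iff₀ hCpos]
  have h2 : 10 * (((n : ℝ) ^ 2 - 1) / 4) * (((n : ℝ) ^ 2 - 1) / 4 - n + 1) * (n - 4) ≤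
      10 * P * (P - n + 1) * (n - 4) := by
    have k0 : (0 : ℝ) ≤ ((n : ℝ) ^ 2 - 1) / 4 - n + 1 := by nlinarith
    have k1 : (0 : ℝ) ≤ n - 4 := by linarith
    have k2 : ((n : ℝ) ^ 2 - 1) / 4 ≤ P := by linarith
    have k3 : (0 : ℝ) ≤ ((n : ℝ) ^ 2 - 1) / 4 := by nlinarith
    have k4 : (0 : ℝ) ≤ P := by linarith
    gcongr
  have h3 : (5 / 8 - 100 / n) * (120 * (n.choose 5 : ℝ)) ≤
      10 * (((n : ℝ) ^ 2 - 1) / 4) * (((n : ℝ) ^ 2 - 1) / 4 - n + 1) * (n - 4) := by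
    by_cases hs : (5 / 8 - 100 / n : ℝ) ≤ 0
    · have : (5 / 8 - 100 / n) * (120 * (n.choose 5 : ℝ)) ≤ 0 :=
        mul_nonpos_of_nonpos_of_nonneg hs (by positivity)
      have k0 : (0 : ℝ) ≤ ((n : ℝ) ^ 2 - 1) / 4 - n + 1 := by nlinarith
      have k1 : (0 : ℝ) ≤ n - 4 := by linarith
      have k3 : (0 : ℝ) ≤ ((n : ℝ) ^ 2 - 1) / 4 := by nlinarith
      have : 0 ≤ 10 * (((n : ℝ) ^ 2 - 1) / 4) * (((n : ℝ) ^ 2 - 1) / 4 - n + 1) * (n - 4) := by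
        positivity
      linarith
    · push Not at hs
      have k1 := mul_le_mul_of_nonneg_left hC hs.le
      have k2 : (5 / 8 - 100 / n) * (n : ℝ) ^ 5 = 5 / 8 * n ^ 5 - 100 * n ^ 4 := by
        have : (n : ℝ) ≠ 0 := by positivity
        field_simp
      have k3 : (0 : ℝ) ≤ n ^ 3 := by positivity
      have k4 : (100 : ℝ) * n ^ 3 ≤ n ^ 4 := by
        have := mul_le_mul_of_nonneg_left hn' k3
        nlinarith
      have k5 : (0 : ℝ) ≤ n ^ 2 := by positivity
      nlinarith
  linarith

lemma lam_tendsto :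
    Filter.Tendsto (fun n => lamKLmax 5 4 n) Filter.atTop (nhds (5/8)) := by
  have h0 : Filter.Tendsto (fun n : ℕ => (100 : ℝ) / n) Filter.atTop (nhds 0) :=
    tendsto_const_div_atTop_nhds_zero_nat 100
  have h1 : Filter.Tendsto (fun n : ℕ => (5 / 8 : ℝ) - 100 / n) Filter.atTop (nhds (5 / 8)) := by
    simpa using h0.const_sub (5 / 8 : ℝ)
  have h2 : Filter.Tendsto (fun n : ℕ => (5 / 8 : ℝ) + 100 / n) Filter.atTop (nhds (5 / 8)) := by
    simpa using h0.const_add (5 / 8 : ℝ)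
  refine tendsto_of_tendsto_of_tendsto_of_le_of_le' h1 h2 ?_ ?_
  · filter_upwards [Filter.eventually_ge_atTop 100] with n hn using lam_lower hn
  · filter_upwards [Filter.eventually_ge_atTop 100] with n hn using lam_upper hn

end Final

theorem edge_inducibility_5_4 :
    Filter.Tendsto (fun n => lamKLmax 5 4 n) Filter.atTop (nhds (5/8)) ∧
    ∃ C : ℝ, 0 < C ∧ ∀ n : ℕ, (C ≤ n) → ∀ G : SimpleGraph (Fin n),
      (distToFam G isTwoCliques : ℝ) ≤ C * (lamKLmax 5 4 n - lamKL 5 4 G) * n ^ 2 := by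
  refine ⟨lam_tendsto, 1000000, by norm_num, fun n hn G => stable ?_ G⟩
  exact_mod_cast hn
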